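/- Suppose the triple (A,𝔫,L) is sincere, i.e., r ≥ 2 and n_i·l_{ij} > 1 for all i, j. If R(A,𝔫,L) is a unique factorization domain, then the linear map P : ℤ^n → ℤ^r given by the matrix P is surjective. -/

import Mathlib

open MvPolynomial

section Setup

variable (𝕂 : Type) [Field 𝕂] [IsAlgClosed 𝕂] [CharZero 𝕂]
variable (r : ℕ) (a : Fin (r+1) → 𝕂 × 𝕂) (n : Fin (r+1) → ℕ)
variable (l : ∀ i : Fin (r+1), Fin (n i) → ℕ)

/-- The index set of the variables `T_{ij}`, `0 ≤ i ≤ r`, `1 ≤ j ≤ n_i`. -/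
abbrev Idx (r : ℕ) (n : Fin (r+1) → ℕ) := Σ i : Fin (r+1), Fin (n i)

/-- The monomial `T_i^{l_i} = T_{i1}^{l_{i1}} ⋯ T_{i n_i}^{l_{i n_i}}`. -/
noncomputable def mono (i : Fin (r+1)) : MvPolynomial (Idx r n) 𝕂 :=
  ∏ j : Fin (n i), (X ⟨i, j⟩ : MvPolynomial (Idx r n) 𝕂) ^ l i j

/-- `α_{ij} = det(a_i, a_j)`. -/
def alpha (i k : Fin (r+1)) : 𝕂 := (a i).1 * (a k).2 - (a k).1 * (a i).2

/-- The trinomial `g_{i,j,k} = α_{jk} T_i^{l_i} + α_{ki} T_j^{l_j} + α_{ij} T_k^{l_k}`. -/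
noncomputable def gPoly (i j k : Fin (r+1)) : MvPolynomial (Idx r n) 𝕂 :=
  C (alpha 𝕂 r a j k) * mono 𝕂 r n l i + C (alpha 𝕂 r a k i) * mono 𝕂 r n l j +
    C (alpha 𝕂 r a i j) * mono 𝕂 r n l k

/-- The ideal `⟨g_{i,i+1,i+2} ; 0 ≤ i ≤ r-2⟩`. -/
noncomputable def relIdeal : Ideal (MvPolynomial (Idx r n) 𝕂) :=
  Ideal.span { p | ∃ i j k : Fin (r+1), (j : ℕ) = (i : ℕ) + 1 ∧ (k : ℕ) = (i : ℕ) + 2 ∧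
    p = gPoly 𝕂 r a n l i j k }

/-- The ring `R(A, 𝔫, L)`. -/
abbrev RAnL := MvPolynomial (Idx r n) 𝕂 ⧸ relIdeal 𝕂 r a n l

/-- Row `i` (for `1 ≤ i ≤ r`) of the `r × n` matrix `P`. -/
def Prow (i : Fin r) : Idx r n → ℤ :=
  fun x => if x.1 = 0 then -(l x.1 x.2 : ℤ) else if x.1 = i.succ then (l x.1 x.2 : ℤ) else 0

/-- The subgroup of `ℤ^n` generated by the rows of `P`. -/
def rowSpan : AddSubgroup (Idx r n → ℤ) := AddSubgroup.closure (Set.range (Prow r n l))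

/-- The grading group `K = ℤ^n / P^*(M)`. -/
abbrev Kgrp := (Idx r n → ℤ) ⧸ rowSpan r n l

/-- The projection `Q : ℤ^n → K`. -/
noncomputable def Qmap : (Idx r n → ℤ) →+ Kgrp r n l := QuotientAddGroup.mk' (rowSpan r n l)

/-- The weight `deg T_{ij} := Q(e_{ij})` defining the `K`-grading of `S`. -/
noncomputable def wK : Idx r n → Kgrp r n l := fun x => Qmap r n l (Pi.single x (1 : ℤ))

/-- An element of `R(A,𝔫,L)` is homogeneous of degree `d` if it is the image of a
`K`-homogeneous polynomial of degree `d`. -/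
def IsHomog (d : Kgrp r n l) (y : RAnL 𝕂 r a n l) : Prop :=
  ∃ p : MvPolynomial (Idx r n) 𝕂, p.IsWeightedHomogeneous (wK r n l) d ∧
    Ideal.Quotient.mk (relIdeal 𝕂 r a n l) p = y

/-- `K`-prime elements of `R(A,𝔫,L)`. -/
def KPrime (f : RAnL 𝕂 r a n l) : Prop :=
  (∃ d, IsHomog 𝕂 r a n l d f) ∧ f ≠ 0 ∧ ¬ IsUnit f ∧
    ∀ x y : RAnL 𝕂 r a n l, (∃ d, IsHomog 𝕂 r a n l d x) → (∃ d, IsHomog 𝕂 r a n l d y) →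
      f ∣ x * y → f ∣ x ∨ f ∣ y

end Setup

section AffineAlgebra

variable {𝕂 : Type} [Field 𝕂] {r : ℕ} {a : Fin (r + 1) → 𝕂 × 𝕂} {n : Fin (r + 1) → ℕ}
  {l : ∀ i : Fin (r + 1), Fin (n i) → ℕ}

theorem alpha_ne_zero (ha : ∀ i k : Fin (r + 1), i ≠ k → LinearIndependent 𝕂 ![a i, a k])
    {i k : Fin (r + 1)} (hik : i ≠ k) : alpha 𝕂 r a i k ≠ 0 := by
  intro h
  have hli := LinearIndependent.pair_iff.1 (ha i k hik)
  unfold alpha at h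
  have h1 := hli (a k).2 (-(a i).2) (by
    ext
    · simp; linear_combination h
    · simp; ring)
  have h2 := hli (a k).1 (-(a i).1) (by
    ext
    · simp; ring
    · simp; linear_combination -h)
  have h3 := hli 1 0 (by
    ext
    · simpa using h2.2
    · simpa using h1.2)
  exact one_ne_zero h3.1

theorem aeval_mono {B : Type} [CommRing B] [Algebra 𝕂 B] (x : Idx r n → B) (i : Fin (r + 1)) :
    aeval x (mono 𝕂 r n l i) = ∏ j, x ⟨i, j⟩ ^ l i j := by
  simp [mono]

/-- A point of the affine variety defined by `relIdeal`, with coordinates in an algebra `B`,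
gives a homomorphism from the coordinate ring. -/
theorem exists_algHom {B : Type} [CommRing B] [Algebra 𝕂 B] (x : Idx r n → B) (u v : B)
    (hx : ∀ i, ∏ j, x ⟨i, j⟩ ^ l i j =
      algebraMap 𝕂 B (a i).1 * u + algebraMap 𝕂 B (a i).2 * v) :
    ∃ φ : RAnL 𝕂 r a n l →ₐ[𝕂] B,
      ∀ p, φ (Ideal.Quotient.mk (relIdeal 𝕂 r a n l) p) = aeval x p := by
  have hle : relIdeal 𝕂 r a n l ≤ RingHom.ker (aeval x : MvPolynomial (Idx r n) 𝕂 →ₐ[𝕂] B) := by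
    refine Ideal.span_le.2 ?_
    rintro _ ⟨i, j, k, -, -, rfl⟩
    simp only [SetLike.mem_coe, RingHom.mem_ker, gPoly, map_add, map_mul, aeval_mono, hx, aeval_C,
      alpha, map_sub]
    ring
  exact ⟨Ideal.Quotient.liftₐ _ (aeval x) fun p hp => hle hp, fun p => rfl⟩

/-- The class of a variable in `RAnL`. -/
noncomputable def var (x : Idx r n) : RAnL 𝕂 r a n l :=
  Ideal.Quotient.mk (relIdeal 𝕂 r a n l) (X x)

theorem mk_eq_aeval_var (p : MvPolynomial (Idx r n) 𝕂) :
    Ideal.Quotient.mk (relIdeal 𝕂 r a n l) p = aeval (var (a := a) (l := l)) p := by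
  have h : Ideal.Quotient.mkₐ 𝕂 (relIdeal 𝕂 r a n l) = aeval (var (a := a) (l := l)) := by
    ext x
    simp [var]
  exact DFunLike.congr_fun h p

theorem algHom_ext_var {B : Type} [CommRing B] [Algebra 𝕂 B] {φ ψ : RAnL 𝕂 r a n l →ₐ[𝕂] B}
    (h : ∀ x, φ (var x) = ψ (var x)) : φ = ψ := by
  refine Ideal.Quotient.algHom_ext _ ?_
  ext x
  exact h x

/-- A sequence satisfying the three-term determinantal relations for consecutive indices is a
combination of the two coefficient sequences. -/
theorem exists_eq_of_trinomial {B : Type} [CommRing B] (b c m : Fin (r + 1) → B)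
    (hunit : ∀ i k, i ≠ k → IsUnit (b i * c k - b k * c i))
    (hrel : ∀ i j k : Fin (r + 1), (j : ℕ) = i + 1 → (k : ℕ) = i + 2 →
      (b j * c k - b k * c j) * m i + (b k * c i - b i * c k) * m j +
        (b i * c j - b j * c i) * m k = 0) (hr : 0 < r) :
    ∃ u v, ∀ i, m i = b i * u + c i * v := by
  obtain ⟨i₀, h₀⟩ : ∃ i : Fin (r + 1), i = ⟨0, by omega⟩ := ⟨_, rfl⟩
  obtain ⟨i₁, h₁⟩ : ∃ i : Fin (r + 1), i = ⟨1, by omega⟩ := ⟨_, rfl⟩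
  obtain ⟨δ, hδ⟩ := hunit i₀ i₁ (by simp [h₀, h₁])
  have hinv := δ.mul_inv
  rw [hδ] at hinv
  refine ⟨δ⁻¹ * (c i₁ * m i₀ - c i₀ * m i₁), δ⁻¹ * (b i₀ * m i₁ - b i₁ * m i₀), ?_⟩
  set u := (δ⁻¹ : Bˣ) * (c i₁ * m i₀ - c i₀ * m i₁) with hu
  set v := (δ⁻¹ : Bˣ) * (b i₀ * m i₁ - b i₁ * m i₀) with hv
  suffices h : ∀ (k : ℕ) (i : Fin (r + 1)), (i : ℕ) = k → m i = b i * u + c i * v from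
    fun i => h i i rfl
  intro k
  induction k using Nat.strong_induction_on with
  | _ k ih =>
    intro i hi
    match k, ih, hi with
    | 0, _, hi =>
      obtain rfl : i = i₀ := Fin.ext (by simp [hi, h₀])
      linear_combination (-m i) * hinv + b i * hu + c i * hv
    | 1, _, hi =>
      obtain rfl : i = i₁ := Fin.ext (by simp [hi, h₁])
      linear_combination (-m i) * hinv + b i * hu + c i * hv
    | k + 2, ih, hi =>
      let i₂ : Fin (r + 1) := ⟨k, by omega⟩
      let i₃ : Fin (r + 1) := ⟨k + 1, by omega⟩
      have h := hrel i₂ i₃ i rfl hi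
      rw [ih k (by omega) i₂ rfl, ih (k + 1) (by omega) i₃ rfl] at h
      refine (hunit i₂ i₃ (by simp [i₂, i₃])).mul_left_cancel ?_
      linear_combination h

/-- The monomials `T_i^{l_i}` are combinations of two elements, with coefficients given by `a`. -/
theorem exists_mono_eq (ha : ∀ i k : Fin (r + 1), i ≠ k → LinearIndependent 𝕂 ![a i, a k])
    (hr : 0 < r) :
    ∃ u v : RAnL 𝕂 r a n l, ∀ i,
      ∏ j, var (a := a) (l := l) ⟨i, j⟩ ^ l i j =
        algebraMap 𝕂 _ (a i).1 * u + algebraMap 𝕂 _ (a i).2 * v := by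
  refine exists_eq_of_trinomial (fun i => algebraMap 𝕂 _ (a i).1)
    (fun i => algebraMap 𝕂 _ (a i).2) _ (fun i k hik => ?_) (fun i j k hj hk => ?_) hr
  · simp only [← map_mul, ← map_sub]
    exact (alpha_ne_zero ha hik).isUnit.map _
  · have hmem : gPoly 𝕂 r a n l i j k ∈ relIdeal 𝕂 r a n l :=
      Ideal.subset_span ⟨i, j, k, hj, hk, rfl⟩
    have h := Ideal.Quotient.eq_zero_iff_mem.2 hmem
    rw [mk_eq_aeval_var] at h
    simpa only [gPoly, alpha, map_add, map_sub, map_mul, aeval_mono, aeval_C] using h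

/-- A common weight vector making all the monomials `T_i^{l_i}` homogeneous of the same degree. -/
theorem exists_weight (hn : ∀ i, 0 < n i) (hl : ∀ i j, 0 < l i j) :
    ∃ (w : Idx r n → ℕ) (D : ℕ), (∀ x, 0 < w x) ∧ ∀ i, ∑ j, w ⟨i, j⟩ * l i j = D := by
  set D := ∏ x : Idx r n, n x.1 * l x.1 x.2 with hD
  have hdvd (x : Idx r n) : n x.1 * l x.1 x.2 ∣ D :=
    Finset.dvd_prod_of_mem (fun x : Idx r n => n x.1 * l x.1 x.2) (Finset.mem_univ x)
  have hDpos : 0 < D := Finset.prod_pos fun x _ => Nat.mul_pos (hn _) (hl _ _)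
  refine ⟨fun x => D / (n x.1 * l x.1 x.2), D, fun x => ?_, fun i => ?_⟩
  · exact Nat.div_pos (Nat.le_of_dvd hDpos (hdvd x)) (Nat.mul_pos (hn _) (hl _ _))
  · refine Nat.eq_of_mul_eq_mul_left (hn i) ?_
    rw [Finset.mul_sum, Finset.sum_congr rfl fun j _ => ?_, Finset.sum_const, Finset.card_fin,
      smul_eq_mul]
    rw [mul_comm (D / _), ← mul_assoc]
    exact Nat.mul_div_cancel' (hdvd ⟨i, j⟩)

theorem prod_C_mul_X_pow {ι B : Type} [Fintype ι] [CommRing B] (y : ι → B) (w e : ι → ℕ) :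
    ∏ j, (Polynomial.C (y j) * Polynomial.X ^ w j) ^ e j =
      Polynomial.C (∏ j, y j ^ e j) * Polynomial.X ^ ∑ j, w j * e j := by
  simp only [mul_pow, ← pow_mul, Finset.prod_mul_distrib, Finset.prod_pow_eq_pow_sum, map_pow,
    map_prod]

/-- The coaction of the grading on the coordinate ring. -/
theorem exists_coaction (ha : ∀ i k : Fin (r + 1), i ≠ k → LinearIndependent 𝕂 ![a i, a k])
    (hr : 0 < r) {w : Idx r n → ℕ} {D : ℕ} (hw : ∀ i, ∑ j, w ⟨i, j⟩ * l i j = D) :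
    ∃ φ : RAnL 𝕂 r a n l →ₐ[𝕂] Polynomial (RAnL 𝕂 r a n l),
      ∀ x, φ (var x) = Polynomial.C (var x) * Polynomial.X ^ w x := by
  obtain ⟨u, v, huv⟩ := exists_mono_eq (l := l) ha hr
  obtain ⟨φ, hφ⟩ := exists_algHom (𝕂 := 𝕂) (a := a) (l := l)
    (fun x => Polynomial.C (var (a := a) (l := l) x) * Polynomial.X ^ w x)
    (Polynomial.C u * Polynomial.X ^ D) (Polynomial.C v * Polynomial.X ^ D) fun i => by
      refine (prod_C_mul_X_pow _ _ _).trans ?_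
      rw [hw, huv]
      simp only [map_add, map_mul, Polynomial.algebraMap_apply]
      ring
  exact ⟨φ, fun x => by simp [var, hφ]⟩

/-- A divisor of a variable is either a constant or vanishes at the origin. -/
theorem eq_algebraMap_or_apply_eq_zero [IsDomain (RAnL 𝕂 r a n l)]
    (ha : ∀ i k : Fin (r + 1), i ≠ k → LinearIndependent 𝕂 ![a i, a k])
    (hr : 0 < r) (hn : ∀ i, 0 < n i) (hl : ∀ i j, 0 < l i j)
    (ev : RAnL 𝕂 r a n l →ₐ[𝕂] 𝕂) (hev : ∀ x, ev (var x) = 0)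
    {x : Idx r n} (hx : var (a := a) (l := l) x ≠ 0) {f g : RAnL 𝕂 r a n l}
    (hfg : var x = f * g) :
    f = algebraMap 𝕂 _ (ev f) ∨ ev f = 0 := by
  obtain ⟨w, D, hwpos, hw⟩ := exists_weight hn hl
  obtain ⟨φ, hφ⟩ := exists_coaction (l := l) ha hr hw
  have h1 (y : RAnL 𝕂 r a n l) : (φ y).eval 1 = y := by
    have h : ((Polynomial.aeval (R := RAnL 𝕂 r a n l) (1 : RAnL 𝕂 r a n l)).restrictScalars 𝕂).comp φ
        = AlgHom.id 𝕂 _ := algHom_ext_var fun x => by simp [hφ]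
    simpa [Polynomial.aeval_def] using DFunLike.congr_fun h y
  have h0 (y : RAnL 𝕂 r a n l) : (φ y).coeff 0 = algebraMap 𝕂 _ (ev y) := by
    have h : ((Polynomial.aeval (R := RAnL 𝕂 r a n l) (0 : RAnL 𝕂 r a n l)).restrictScalars 𝕂).comp φ
        = (Algebra.ofId 𝕂 (RAnL 𝕂 r a n l)).comp ev :=
      algHom_ext_var fun x => by simp [hφ, hev, (hwpos x).ne']
    rw [Polynomial.coeff_zero_eq_eval_zero]
    simpa [Polynomial.aeval_def] using DFunLike.congr_fun h y
  have hne : φ f * φ g ≠ 0 := by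
    rw [← map_mul, ← hfg, hφ]
    simpa using hx
  have hf := left_ne_zero_of_mul hne
  have hg := right_ne_zero_of_mul hne
  have hprod : φ f * φ g = Polynomial.C (var x) * Polynomial.X ^ w x := by
    rw [← map_mul, ← hfg, hφ]
  have hdeg := Polynomial.natDegree_mul hf hg
  have htdeg := Polynomial.natTrailingDegree_mul hf hg
  rw [hprod, Polynomial.natDegree_C_mul_X_pow _ _ hx] at hdeg
  rw [hprod, Polynomial.C_mul_X_pow_eq_monomial, Polynomial.natTrailingDegree_monomial hx] at htdeg
  have hle1 := Polynomial.natTrailingDegree_le_natDegree (φ f)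
  have hle2 := Polynomial.natTrailingDegree_le_natDegree (φ g)
  by_cases hzero : (φ f).natDegree = 0
  · left
    rw [← h0]
    conv_lhs => rw [← h1 f, Polynomial.eq_C_of_natDegree_eq_zero hzero, Polynomial.eval_C]
  · right
    have h := Polynomial.coeff_eq_zero_of_lt_natTrailingDegree
      (show 0 < (φ f).natTrailingDegree by omega)
    rwa [h0, map_eq_zero_iff _ (algebraMap 𝕂 (RAnL 𝕂 r a n l)).injective] at h

/-- Sincerity makes the class of every variable irreducible. -/
theorem irreducible_var [IsDomain (RAnL 𝕂 r a n l)]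
    (ha : ∀ i k : Fin (r + 1), i ≠ k → LinearIndependent 𝕂 ![a i, a k])
    (hr : 0 < r) (hn : ∀ i, 0 < n i) (hl : ∀ i j, 0 < l i j)
    (hsincere : ∀ (i : Fin (r + 1)) (j : Fin (n i)), 1 < n i * l i j) (x : Idx r n) :
    Irreducible (var (a := a) (l := l) x) := by
  classical
  obtain ⟨ψ, hψ⟩ := exists_algHom (a := a) (l := l)
    (fun y => if y = x then (DualNumber.eps : DualNumber 𝕂) else 0) 0 0 fun i => by
      simp only [mul_zero, add_zero]
      by_cases h : ∃ j, (⟨i, j⟩ : Idx r n) ≠ x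
      · obtain ⟨j, hj⟩ := h
        exact Finset.prod_eq_zero (Finset.mem_univ j) (by simp [hj, (hl i j).ne'])
      · push Not at h
        obtain rfl := h ⟨0, hn i⟩
        have hsub : n i ≤ 1 := by
          by_contra! hlt
          simpa using h ⟨1, hlt⟩
        have h2 : 2 ≤ l i ⟨0, hn i⟩ := by
          have := hsincere i ⟨0, hn i⟩
          nlinarith
        refine Finset.prod_eq_zero (Finset.mem_univ ⟨0, hn i⟩) ?_
        rw [if_pos rfl, ← Nat.sub_add_cancel h2, pow_add, DualNumber.eps_pow_two, mul_zero]
  have hψvar (y : Idx r n) : ψ (var y) = if y = x then DualNumber.eps else 0 := by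
    simp [var, hψ]
  let ev := (TrivSqZeroExt.fstHom 𝕂 𝕂 𝕂).comp ψ
  have hev (y : Idx r n) : ev (var y) = 0 := by
    simp only [ev, AlgHom.comp_apply, hψvar]
    split_ifs <;> simp
  have hne : ψ (var x) ≠ 0 := by
    rw [hψvar, if_pos rfl]
    intro h
    simpa using congrArg TrivSqZeroExt.snd h
  have hx : var (a := a) (l := l) x ≠ 0 := fun h => hne (by rw [h, map_zero])
  have hunit {f g : RAnL 𝕂 r a n l} (hfg : var x = f * g) (hf : ev f ≠ 0) : IsUnit f := by
    rcases eq_algebraMap_or_apply_eq_zero ha hr hn hl ev hev hx hfg with h | h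
    · rw [h]
      exact hf.isUnit.map _
    · exact absurd h hf
  refine ⟨fun h => (h.map ev).ne_zero (hev x), fun f g hfg => ?_⟩
  by_cases hf : ev f = 0
  · by_cases hg : ev g = 0
    · refine absurd ?_ hne
      rw [hfg, map_mul]
      ext
      · simp [show TrivSqZeroExt.fst (ψ f) = 0 from hf]
      · simp [show TrivSqZeroExt.fst (ψ f) = 0 from hf, show TrivSqZeroExt.fst (ψ g) = 0 from hg]
    · exact Or.inr (hunit (hfg.trans (mul_comm f g)) hg)
  · exact Or.inl (hunit hfg hf)

theorem Irreducible.prime_of_multiset_prod {R : Type} [CommRing R] [IsDomain R] {q : R}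
    (hq : Irreducible q) {ms : Multiset R} (hms : ∀ p ∈ ms, Prime p) (hprod : ms.prod = q) :
    Prime q := by
  induction ms using Multiset.induction_on with
  | empty => exact absurd (by simp [← hprod]) hq.not_isUnit
  | cons p t _ =>
    have hp := hms p (Multiset.mem_cons_self p t)
    rw [Multiset.prod_cons] at hprod
    have ht := (hq.isUnit_or_isUnit hprod.symm).resolve_left hp.not_isUnit
    rw [← hprod]
    exact (associated_mul_unit_right p _ ht).prime hp

/-- The equation `z ^ (d * e) = c` has a solution for which `z ^ e` avoids a given value. -/
theorem exists_pow_eq_and_ne [IsAlgClosed 𝕂] [CharZero 𝕂] {d e : ℕ} (hd : 1 < d) (he : 0 < e)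
    {c β : 𝕂} (hc : c ≠ 0) (hβ : β ≠ 0) (t : 𝕂) : ∃ z, z ^ (d * e) = c ∧ β * z ^ e ≠ t := by
  have hde : 0 < d * e := Nat.mul_pos (by omega) he
  obtain ⟨z, hz⟩ := IsAlgClosed.exists_pow_nat_eq c hde
  by_cases h : β * z ^ e = t
  · have : NeZero (d * e) := ⟨hde.ne'⟩
    obtain ⟨ω, hω⟩ := HasEnoughRootsOfUnity.exists_primitiveRoot 𝕂 (d * e)
    refine ⟨z * ω, by rw [mul_pow, hz, hω.pow_eq_one, mul_one], fun h' => ?_⟩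
    have hz0 : z ^ e ≠ 0 := by
      rintro h0
      rw [mul_comm, pow_mul, h0, zero_pow (by omega)] at hz
      exact hc hz.symm
    rw [mul_pow, ← mul_assoc, h, ← h] at h'
    exact hω.pow_ne_one_of_pos_of_lt he.ne' (by nlinarith)
      ((mul_eq_left₀ (mul_ne_zero hβ hz0)).1 h')
  · exact ⟨z, hz, h⟩

/-- If a variable in block `k` is prime, the exponents of two other blocks have no common
divisor. -/
theorem eq_one_of_dvd [IsAlgClosed 𝕂] [CharZero 𝕂] [IsDomain (RAnL 𝕂 r a n l)]
    (ha : ∀ i k : Fin (r + 1), i ≠ k → LinearIndependent 𝕂 ![a i, a k])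
    (hr : 0 < r) (hn : ∀ i, 0 < n i) (hl : ∀ i j, 0 < l i j) {i j k : Fin (r + 1)}
    (hij : i ≠ j) (hik : i ≠ k) (hjk : j ≠ k)
    (hprime : Prime (var (a := a) (l := l) ⟨k, ⟨0, hn k⟩⟩)) {d : ℕ}
    (hdi : ∀ s, d ∣ l i s) (hdj : ∀ s, d ∣ l j s) : d = 1 := by
  classical
  by_contra hd1
  have hd0 : d ≠ 0 := by
    rintro rfl
    exact (hl i ⟨0, hn i⟩).ne' (zero_dvd_iff.1 (hdi ⟨0, hn i⟩))
  choose e he using hdi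
  choose e' he' using hdj
  obtain ⟨u, v, huv⟩ := exists_mono_eq (l := l) ha hr
  set R := RAnL 𝕂 r a n l
  obtain ⟨β, hβ⟩ := IsAlgClosed.exists_pow_nat_eq (alpha 𝕂 r a j k) (Nat.pos_of_ne_zero hd0)
  obtain ⟨γ, hγ⟩ := IsAlgClosed.exists_pow_nat_eq (-alpha 𝕂 r a k i) (Nat.pos_of_ne_zero hd0)
  have hβ0 : β ≠ 0 := by
    rintro rfl
    exact alpha_ne_zero ha hjk (by rw [← hβ, zero_pow hd0])
  have : NeZero d := ⟨hd0⟩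
  obtain ⟨ω, hω⟩ := HasEnoughRootsOfUnity.exists_primitiveRoot 𝕂 d
  have hωR : IsPrimitiveRoot (algebraMap 𝕂 R ω) d :=
    hω.map_of_injective (algebraMap 𝕂 R).injective
  set Y : R := ∏ s, var ⟨i, s⟩ ^ e s with hY
  set Y' : R := ∏ s, var ⟨j, s⟩ ^ e' s with hY'
  have hYd : Y ^ d = ∏ s, var ⟨i, s⟩ ^ l i s := by
    simp only [hY, ← Finset.prod_pow, ← pow_mul, he, mul_comm]
  have hYd' : Y' ^ d = ∏ s, var ⟨j, s⟩ ^ l j s := by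
    simp only [hY', ← Finset.prod_pow, ← pow_mul, he', mul_comm]
  have hfac := hωR.pow_sub_pow_eq_prod_sub_mul (algebraMap 𝕂 R β * Y) (algebraMap 𝕂 R γ * Y')
    (Nat.pos_of_ne_zero hd0)
  have hrel : (algebraMap 𝕂 R β * Y) ^ d - (algebraMap 𝕂 R γ * Y') ^ d =
      -algebraMap 𝕂 R (alpha 𝕂 r a i j) * ∏ s, var ⟨k, s⟩ ^ l k s := by
    rw [mul_pow, mul_pow, hYd, hYd', ← map_pow, ← map_pow, hβ, hγ, huv, huv, huv]
    simp only [alpha, map_neg, map_sub, map_mul]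
    ring
  have hdvd : var ⟨k, ⟨0, hn k⟩⟩ ∣ ∏ s, var (a := a) (l := l) ⟨k, s⟩ ^ l k s :=
    (dvd_pow_self _ (hl k ⟨0, hn k⟩).ne').trans
      (Finset.dvd_prod_of_mem (fun s => var (a := a) (l := l) ⟨k, s⟩ ^ l k s)
        (Finset.mem_univ (⟨0, hn k⟩ : Fin (n k))))
  have hdvd' := dvd_mul_of_dvd_right hdvd (-algebraMap 𝕂 R (alpha 𝕂 r a i j))
  rw [← hrel, hfac] at hdvd'
  obtain ⟨ζ, hζ, hζdvd⟩ := hprime.exists_mem_finset_dvd hdvd'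
  obtain ⟨m, -, rfl⟩ := hωR.eq_pow_of_pow_eq_one
    ((Polynomial.mem_nthRootsFinset (Nat.pos_of_ne_zero hd0) 1).1 hζ)
  have hroot (s : Fin (r + 1)) : ∃ z, z ^ l s ⟨0, hn s⟩ = alpha 𝕂 r a s k :=
    IsAlgClosed.exists_pow_nat_eq _ (hl s _)
  choose z hz using hroot
  obtain ⟨z', hz', hne⟩ := exists_pow_eq_and_ne (d := d) (e := e ⟨0, hn i⟩) (by omega)
    (Nat.pos_of_mul_pos_left (by rw [← he]; exact hl i _)) (alpha_ne_zero ha hik) hβ0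
    (ω ^ m * (γ * z j ^ e' ⟨0, hn j⟩))
  rw [← he] at hz'
  set y : Fin (r + 1) → 𝕂 := Function.update z i z' with hy
  have hyi : y i = z' := Function.update_self ..
  have hyj : y j = z j := Function.update_of_ne hij.symm ..
  have hyk : y k = 0 := by
    rw [hy, Function.update_of_ne hik.symm]
    exact eq_zero_of_pow_eq_zero ((hz k).trans (by simp [alpha]))
  have hypow (s : Fin (r + 1)) : y s ^ l s ⟨0, hn s⟩ = alpha 𝕂 r a s k := by
    by_cases h : s = i
    · subst h
      rw [hyi, hz']
    · rw [hy, Function.update_of_ne h, hz]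
  have hprod (s : Fin (r + 1)) (f : Fin (n s) → ℕ) :
      ∏ t, (if t = ⟨0, hn s⟩ then y s else 1) ^ f t = y s ^ f ⟨0, hn s⟩ := by
    simp only [ite_pow, one_pow, Finset.prod_ite_eq', Finset.mem_univ, if_true]
  obtain ⟨φ, hφ⟩ := exists_algHom (a := a) (l := l)
    (fun x => if x.2 = ⟨0, hn x.1⟩ then y x.1 else 1) (a k).2 (-(a k).1) fun s => by
      rw [hprod s (l s), hypow]
      simp only [alpha, Algebra.algebraMap_self, RingHom.id_apply]
      ring
  have hφvar (x : Idx r n) : φ (var x) = if x.2 = ⟨0, hn x.1⟩ then y x.1 else 1 := by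
    simp [var, hφ]
  have h := map_dvd φ hζdvd
  rw [hφvar, if_pos rfl, hyk, zero_dvd_iff] at h
  have hconst (b : 𝕂) : φ (algebraMap 𝕂 R b) = b := φ.commutes b
  have hφY : φ Y = z' ^ e ⟨0, hn i⟩ := by
    rw [hY, map_prod, ← hyi, ← hprod i e]
    simp only [map_pow, hφvar]
  have hφY' : φ Y' = z j ^ e' ⟨0, hn j⟩ := by
    rw [hY', map_prod, ← hyj, ← hprod j e']
    simp only [map_pow, hφvar]
  simp only [map_sub, map_mul, map_pow, hconst, hφY, hφY'] at h
  exact hne (sub_eq_zero.1 h)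

end AffineAlgebra

section Lattice

variable {r : ℕ} {n : Fin (r + 1) → ℕ} {l : ∀ i : Fin (r + 1), Fin (n i) → ℕ}

theorem sum_Prow_mul (v : Idx r n → ℤ) (i : Fin r) :
    ∑ x, Prow r n l i x * v x =
      ∑ j, v ⟨i.succ, j⟩ * l i.succ j - ∑ j, v ⟨0, j⟩ * l 0 j := by
  rw [Fintype.sum_sigma, Fin.sum_univ_succ, Finset.sum_eq_single i]
  · simp [Prow, Fin.succ_ne_zero, mul_comm]
    ring
  · intro k _ hk
    simp [Prow, hk, Fin.succ_ne_zero]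
  · simp

theorem isCoprime_span_of_dvd {m m' : ℕ} (f : Fin m → ℕ) (g : Fin m' → ℕ)
    (h : ∀ d : ℕ, (∀ s, d ∣ f s) → (∀ s, d ∣ g s) → d = 1) :
    IsCoprime (Ideal.span (Set.range fun s => (f s : ℤ)))
      (Ideal.span (Set.range fun s => (g s : ℤ))) := by
  rw [Ideal.isCoprime_iff_sup_eq]
  set J := Ideal.span (Set.range fun s => (f s : ℤ)) ⊔ Ideal.span (Set.range fun s => (g s : ℤ))
  have hdvd (t : ℕ) (ht : (t : ℤ) ∈ J) : (Submodule.IsPrincipal.generator J).natAbs ∣ t :=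
    Int.natAbs_dvd_natAbs.2 ((Submodule.IsPrincipal.mem_iff_generator_dvd J).1 ht)
  have h1 := h _ (fun s => hdvd _ (Ideal.mem_sup_left (Ideal.subset_span ⟨s, rfl⟩)))
    (fun s => hdvd _ (Ideal.mem_sup_right (Ideal.subset_span ⟨s, rfl⟩)))
  exact Ideal.eq_top_of_isUnit_mem _ (Submodule.IsPrincipal.generator_mem J)
    (Int.isUnit_iff_natAbs_eq.2 h1)

/-- The matrix `P` is surjective if the exponents in any two blocks have no common divisor. -/
theorem surjective_Prow (h : ∀ i j : Fin (r + 1), i ≠ j →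
      ∀ d : ℕ, (∀ s, d ∣ l i s) → (∀ s, d ∣ l j s) → d = 1) :
    Function.Surjective
      (fun (v : Idx r n → ℤ) (i : Fin r) => ∑ x : Idx r n, Prow r n l i x * v x) := by
  intro w
  obtain ⟨q, hq⟩ := Ideal.exists_forall_sub_mem_ideal
    (I := fun i : Fin (r + 1) => Ideal.span (Set.range fun s => (l i s : ℤ)))
    (fun i j hij => isCoprime_span_of_dvd _ _ (h i j hij)) (Fin.cons 0 fun i => -w i)
  choose c hc using fun i => Ideal.mem_span_range_iff_exists_fun.1 (hq i)
  refine ⟨fun x => c x.1 x.2, funext fun i => ?_⟩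
  refine (sum_Prow_mul _ i).trans ?_
  rw [hc i.succ, hc 0]
  simp

end Lattice


section Statement15

/-- If `(A,𝔫,L)` is sincere and `R(A,𝔫,L)` is a unique factorization domain (an
integral domain in which every nonzero nonunit is a product of primes), then the
linear map `P : ℤ^n → ℤ^r` is surjective. -/
theorem statement15 (𝕂 : Type) [Field 𝕂] [IsAlgClosed 𝕂] [CharZero 𝕂]
    (r : ℕ) (hr : 2 ≤ r) (a : Fin (r+1) → 𝕂 × 𝕂)
    (ha : ∀ i k : Fin (r+1), i ≠ k → LinearIndependent 𝕂 ![a i, a k])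
    (n : Fin (r+1) → ℕ) (hn : ∀ i, 0 < n i)
    (l : ∀ i : Fin (r+1), Fin (n i) → ℕ) (hl : ∀ i j, 0 < l i j)
    (hsincere : ∀ (i : Fin (r+1)) (j : Fin (n i)), 1 < n i * l i j)
    (hUFD : IsDomain (RAnL 𝕂 r a n l) ∧
      ∀ f : RAnL 𝕂 r a n l, f ≠ 0 → ¬ IsUnit f →
        ∃ ms : Multiset (RAnL 𝕂 r a n l), (∀ p ∈ ms, Prime p) ∧ ms.prod = f) :
    Function.Surjective
      (fun (v : Idx r n → ℤ) (i : Fin r) => ∑ x : Idx r n, Prow r n l i x * v x) := by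
  have := hUFD.1
  have hprime (x : Idx r n) : Prime (var (a := a) (l := l) x) := by
    have hirr := irreducible_var ha (by omega) hn hl hsincere x
    obtain ⟨ms, hms, hprod⟩ := hUFD.2 _ hirr.ne_zero hirr.not_isUnit
    exact hirr.prime_of_multiset_prod hms hprod
  refine surjective_Prow fun i j hij d hdi hdj => ?_
  obtain ⟨k, hk⟩ : ∃ k, k ∉ ({i, j} : Finset (Fin (r + 1))) := by
    by_contra! hall
    have h1 := Finset.card_le_card (fun k _ => hall k : Finset.univ ⊆ _)
    have h2 := Finset.card_le_two (a := i) (b := j)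
    rw [Finset.card_fin] at h1
    omega
  simp only [Finset.mem_insert, Finset.mem_singleton, not_or] at hk
  exact eq_one_of_dvd ha (by omega) hn hl hij (Ne.symm hk.1) (Ne.symm hk.2) (hprime _) hdi hdj

end Statement15
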